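/- Let d ≥ 2, 1 < p₀ < d, 𝔇 = d − p₀, λ = 2^{(1−d)/𝔇}, γ ∈ ℝ, and let u and b be the subdimensional competitor and auxiliary function on Ω = (−1,1)^d. Let α > 0, 1 < p < q < ∞, let ρ_a ∈ C^∞(ℝ^d \ (𝔠^{d−1}_{λ,γ} × {0})) satisfy 1_{{dist(x̄, 𝔠^{d−1}_{λ,γ}) ≤ |x_d|/2}} ≤ ρ_a ≤ 1_{{dist(x̄, 𝔠^{d−1}_{λ,γ}) ≤ 2|x_d|}} and |∇ρ_a| ≤ C|x_d|^{−1} 1_{{|x_d|/2 ≤ dist(x̄, 𝔠^{d−1}_{λ,γ}) ≤ 2|x_d|}}, and define a(x) = |x_d|^α ρ_a(x), φ(x,t) = t^p/p + a(x) t^q/q, F(w) = ∫_Ω φ(x, |∇w|) dx, F*(f) = ∫_Ω φ*(x, |f|) dx with φ*(x,s) = sup_{t≥0}(st − φ(x,t)). If q > p₀ + α, and either p < p₀, or p = p₀ and γ𝔇 < −1, then F(u) < ∞, F*(b) < ∞, and for every κ > 0 there exist η, s > 0 such that F(η u) + F*(s b) < κ η s. -/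

import Mathlib

open MeasureTheory Real Set Metric Filter Topology NNReal ENNReal

noncomputable section

/-- `ℝ^n` with the Euclidean structure. -/
abbrev Euc (n : ℕ) := EuclideanSpace ℝ (Fin n)

/-- The open cube `(-1,1)^n`. -/
def Box (n : ℕ) : Set (Euc n) := {x | ∀ i, |x i| < 1}

/-- The last coordinate `x_d` of `x ∈ ℝ^{n+1}`. -/
def lastC {n : ℕ} (x : Euc (n + 1)) : ℝ := x (Fin.last n)

/-- The first `n` coordinates `x̄` of `x ∈ ℝ^{n+1}`. -/
def frontC {n : ℕ} (x : Euc (n + 1)) : Euc n := WithLp.toLp 2 fun i => x i.castSucc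

/-- Assemble a point of `ℝ^{n+1}` from `x̄ ∈ ℝ^n` and a last coordinate. -/
def snocC {n : ℕ} (xb : Euc n) (t : ℝ) : Euc (n + 1) :=
  WithLp.toLp 2 (Fin.snoc (α := fun _ => ℝ) xb.ofLp t)

/-- The first `m` coordinates of `x ∈ ℝ^{m+k}`. -/
def barPart {m k : ℕ} (x : Euc (m + k)) : Euc m :=
  WithLp.toLp 2 fun i => x (Fin.castAdd k i)

/-- The last `k` coordinates of `x ∈ ℝ^{m+k}`. -/
def hatPart {m k : ℕ} (x : Euc (m + k)) : Euc k :=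
  WithLp.toLp 2 fun i => x (Fin.natAdd m i)

/-- Admissibility of a sequence of interval lengths for the generalized `(λ,γ)`-Cantor set:
`l 0 = 1`, the lengths decrease fast enough (`l_{j-1} > 2 l_j`, removed gaps decreasing), and
`l j` is comparable to `λ^j j^γ`. -/
def IsCantorLengths (lam gam : ℝ) (l : ℕ → ℝ) : Prop :=
  l 0 = 1 ∧ (∀ j, 0 < l j) ∧ (∀ j, 2 * l (j + 1) < l j) ∧
    (∀ j, l (j + 1) - 2 * l (j + 2) < l j - 2 * l (j + 1)) ∧
    ∃ C : ℝ, 1 ≤ C ∧ ∀ j : ℕ, 1 ≤ j →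
      C⁻¹ * lam ^ j * (j : ℝ) ^ gam ≤ l j ∧ l j ≤ C * lam ^ j * (j : ℝ) ^ gam

/-- The point of the generalized Cantor set with address `ε` (left endpoints of the nested
intervals converge to this point). -/
def gCantorPoint (l : ℕ → ℝ) (ε : ℕ → Bool) : ℝ :=
  -(1 / 2 : ℝ) + ∑' j : ℕ, if ε j then l j - l (j + 1) else 0

/-- The generalized Cantor set determined by the lengths `l`. -/
def gCantorSet (l : ℕ → ℝ) : Set ℝ := Set.range (gCantorPoint l)

/-- The `m`-fold Cartesian power of the generalized Cantor set, inside `ℝ^m`. -/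
def gCantorSetPi (l : ℕ → ℝ) (m : ℕ) : Set (Euc m) := {x | ∀ i, x i ∈ gCantorSet l}

/-- The `j`-th binary digit of `t`. -/
def binDigit (t : ℝ) (j : ℕ) : Bool := ⌊t * 2 ^ (j + 1)⌋ % 2 = 1

/-- The Cantor measure attached to the lengths `l`: the image of the uniform distribution on
`[0,1)` under the map sending `t` to the Cantor point whose address is the binary digit
sequence of `t` (the digits being i.i.d. fair coins, this is the weak limit of the uniform
distributions on the pre-Cantor sets). -/
def gCantorMeasure (l : ℕ → ℝ) : Measure ℝ :=
  Measure.map (fun t => gCantorPoint l (binDigit t)) (volume.restrict (Set.Ico (0 : ℝ) 1))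

/-- The `m`-fold product of the Cantor measure, as a measure on `ℝ^m`. -/
def gCantorMeasurePi (l : ℕ → ℝ) (m : ℕ) : Measure (Euc m) :=
  Measure.map (⇑(MeasurableEquiv.toLp 2 (Fin m → ℝ)))
    (Measure.pi fun _ : Fin m => gCantorMeasure l)

/-- The fractal dimension `𝔇 = m log 2 / log(1/λ)`. -/
def frD (m : ℕ) (lam : ℝ) : ℝ := m * Real.log 2 / Real.log lam⁻¹

/-- `G` is the weak (distributional) differential of `u` on `Ω`:
integration by parts against smooth compactly supported test functions holds. -/
def HasWeakFDerivOn {n : ℕ} (Ω : Set (Euc n)) (u : Euc n → ℝ)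
    (G : Euc n → Euc n →L[ℝ] ℝ) : Prop :=
  ∀ φ : Euc n → ℝ, ContDiff ℝ (⊤ : ℕ∞) φ → HasCompactSupport φ → tsupport φ ⊆ Ω →
    ∫ x in Ω, u x • fderiv ℝ φ x = -∫ x in Ω, φ x • G x

/-- `u ∈ W^{1,1}(Ω)` with weak differential `G`. -/
def W11On {n : ℕ} (Ω : Set (Euc n)) (u : Euc n → ℝ) (G : Euc n → Euc n →L[ℝ] ℝ) : Prop :=
  IntegrableOn u Ω ∧ IntegrableOn G Ω ∧ HasWeakFDerivOn Ω u G

/-- `w ∈ W^{1,1}_0(Ω)` (with weak differential `G`): the extensions by zero form a Sobolev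
function on all of `ℝ^n`. -/
def ZeroBoundary {n : ℕ} (Ω : Set (Euc n)) (w : Euc n → ℝ)
    (G : Euc n → Euc n →L[ℝ] ℝ) : Prop :=
  Integrable (Set.indicator Ω w) ∧ Integrable (Set.indicator Ω G) ∧
    HasWeakFDerivOn Set.univ (Set.indicator Ω w) (Set.indicator Ω G)

/-- The energy `∫_Ω φ(x, g x) dx` for a scalar field `g` (typically `g = |∇w|`). -/
def energyOf {n : ℕ} (Ω : Set (Euc n)) (φ : Euc n → ℝ → ℝ) (g : Euc n → ℝ) : ℝ≥0∞ :=
  ∫⁻ x in Ω, ENNReal.ofReal (φ x (g x))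

/-- The Young (Legendre–Fenchel) conjugate `φ*(s) = sup_{t ≥ 0} (s t − φ(t))`. -/
def conjOrlicz (φ : ℝ → ℝ) (s : ℝ) : ℝ≥0∞ :=
  ⨆ t : ℝ≥0, ENNReal.ofReal (s * t - φ t)

/-- The conjugate energy `∫_Ω φ*(x, g x) dx`. -/
def energyConj {n : ℕ} (Ω : Set (Euc n)) (φ : Euc n → ℝ → ℝ) (g : Euc n → ℝ) : ℝ≥0∞ :=
  ∫⁻ x in Ω, conjOrlicz (φ x) (g x)

/-- `u` (with weak differential `G`, finite energy) is a local minimizer of the functional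
`w ↦ ∫_Ω φ(x,|∇w|) dx`: its energy does not exceed that of any Sobolev competitor that agrees
with `u` a.e. outside a compact subset of `Ω`. -/
def IsLocalMinimizer {n : ℕ} (Ω : Set (Euc n)) (φ : Euc n → ℝ → ℝ) (u : Euc n → ℝ)
    (G : Euc n → Euc n →L[ℝ] ℝ) : Prop :=
  W11On Ω u G ∧ energyOf Ω φ (fun x => ‖G x‖) < ⊤ ∧
    ∀ v Gv, W11On Ω v Gv →
      (∃ K : Set (Euc n), IsCompact K ∧ K ⊆ Ω ∧ ∀ᵐ x ∂(volume.restrict Ω), x ∉ K → v x = u x) →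
      energyOf Ω φ (fun x => ‖G x‖) ≤ energyOf Ω φ (fun x => ‖Gv x‖)

/-- `x` is a non-Lebesgue point of `u`: the averages of `|u − c|` on small balls around `x`
do not converge to `0` for any constant `c`. -/
def IsNonLebesguePoint {n : ℕ} (u : Euc n → ℝ) (x : Euc n) : Prop :=
  ¬ ∃ c : ℝ, Tendsto (fun r : ℝ => ⨍ y in Metric.ball x r, |u y - c| ∂volume)
      (𝓝[>] (0 : ℝ)) (𝓝 0)

/-- Membership in the Hölder class `C^α` on `s` (for `α ≥ 1` interpreted via
`C^{⌊α⌋, α − ⌊α⌋}`). -/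
def InHolderCls {n : ℕ} (α : ℝ) (s : Set (Euc n)) (a : Euc n → ℝ) : Prop :=
  ContDiffOn ℝ (⌊α⌋₊ : ℕ) a s ∧
    ∃ C : ℝ≥0, HolderOnWith C (Real.toNNReal (α - ⌊α⌋₊))
      (fun x => iteratedFDerivWithin ℝ ⌊α⌋₊ a s x) s

/-- The restricted Riesz potential `I₁^⋈(|f|)(x̄,0) = ∫_{C((x̄,0))} |f(y)| |x−y|^{1−d} dy`,
where `C(x)` is the double cone `{y : |ȳ − x̄| ≤ |y_d − x_d|/2}` (here `d = n+1`). -/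
def rieszBow {n : ℕ} (f : Euc (n + 1) → ℝ) (xb : Euc n) : ℝ≥0∞ :=
  ∫⁻ y : Euc (n + 1),
    ENNReal.ofReal ((if dist (frontC y) xb ≤ |lastC y| / 2 then (1 : ℝ) else 0) *
      |f y| * Real.sqrt (dist (frontC y) xb ^ 2 + lastC y ^ 2) ^ (-(n : ℝ)))

/-- The upper average `⟨f⟩⁺_{x̄,r} = ∫_{B_1} ω(y) f(x̄ + |r| ȳ, |r| y_d + |r|) dy`. -/
def avgPlus {n : ℕ} (ω : Euc (n + 1) → ℝ) (f : Euc (n + 1) → ℝ) (xb : Euc n) (r : ℝ) : ℝ :=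
  ∫ y in Metric.ball (0 : Euc (n + 1)) 1,
    ω y * f (snocC (xb + |r| • frontC y) (|r| * lastC y + |r|))

/-- The lower average `⟨f⟩⁻_{x̄,r} = ∫_{B_1} ω(y) f(x̄ + |r| ȳ, |r| y_d − |r|) dy`. -/
def avgMinus {n : ℕ} (ω : Euc (n + 1) → ℝ) (f : Euc (n + 1) → ℝ) (xb : Euc n) (r : ℝ) : ℝ :=
  ∫ y in Metric.ball (0 : Euc (n + 1)) 1,
    ω y * f (snocC (xb + |r| • frontC y) (|r| * lastC y - |r|))

open Classical in
/-- The function `u_d(x) = (1/2) sgn(x_d) θ(|x_d|/|x̄|)` (extended by its natural limit value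
`(1/2) sgn(x_d)` on the line `x̄ = 0`). -/
def uD {n : ℕ} (θ : ℝ → ℝ) (x : Euc (n + 1)) : ℝ :=
  if frontC x = 0 then (1 / 2) * Real.sign (lastC x)
  else (1 / 2) * Real.sign (lastC x) * θ (|lastC x| / ‖frontC x‖)

/-- Hypotheses on the profile function `θ`:
smooth on `(0,∞)`, `1_{(1/2,∞)} ≤ θ ≤ 1_{(1/4,∞)}` and `‖θ'‖_∞ ≤ 6`. -/
def IsProfile (θ : ℝ → ℝ) : Prop :=
  ContDiffOn ℝ (⊤ : ℕ∞) θ (Set.Ioi 0) ∧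
    (∀ t : ℝ, 0 < t → (if 1 / 2 < t then (1 : ℝ) else 0) ≤ θ t) ∧
    (∀ t : ℝ, 0 < t → θ t ≤ if 1 / 4 < t then 1 else 0) ∧
    (∀ t : ℝ, 0 < t → |deriv θ t| ≤ 6)

end

lemma aux_summable {x τ : ℝ} (hx0 : 0 < x) (h : x < 1 ∨ (x = 1 ∧ τ < -1)) :
    Summable (fun j : ℕ => x ^ j * (j : ℝ) ^ τ) := by
  rcases h with h | ⟨h, hτ⟩
  · have hs := summable_pow_mul_geometric_of_norm_lt_one (R := ℝ) (⌈|τ|⌉₊)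
      (r := x) (by rw [Real.norm_eq_abs, abs_of_pos hx0]; exact h)
    have hs2 := hs.add (summable_geometric_of_lt_one hx0.le h)
    refine Summable.of_nonneg_of_le (fun j => by positivity) (fun j => ?_) hs2
    rcases Nat.eq_zero_or_pos j with rfl | hj
    · simp only [pow_zero, Nat.cast_zero, one_mul, mul_one]
      have h1 : (0:ℝ) ^ τ ≤ 1 := by
        by_cases h0 : τ = 0
        · simp [h0]
        · simp [Real.zero_rpow h0]
      have : (0:ℝ) ≤ 0 ^ ⌈|τ|⌉₊ := by positivity
      linarith
    · have hj1 : (1:ℝ) ≤ j := by exact_mod_cast hj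
      have h1 : (j:ℝ) ^ τ ≤ (j:ℝ) ^ ⌈|τ|⌉₊ := by
        rw [← Real.rpow_natCast]
        exact Real.rpow_le_rpow_of_exponent_le hj1 ((le_abs_self τ).trans (Nat.le_ceil _))
      have h2 : 0 < x ^ j := by positivity
      nlinarith
  · subst h
    simpa using Real.summable_nat_rpow.2 hτ

lemma aux_log {τ e : ℝ} (he : 0 < e) : ∃ C : ℝ, 0 < C ∧ ∀ r : ℝ, 0 < r → r < 1 →
    Real.log (Real.exp 1 + r⁻¹) ^ τ ≤ C * r ^ (-e) := by
  set T := |τ| + 1 with hT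
  have hTpos : 0 < T := by positivity
  refine ⟨(1 / (e / T)) ^ T * 4 ^ e, by positivity, fun r hr hr1 => ?_⟩
  have hri : 1 < r⁻¹ := (one_lt_inv₀ hr).2 hr1
  have hx1 : Real.exp 1 ≤ Real.exp 1 + r⁻¹ := by linarith
  have hx2 : Real.exp 1 + r⁻¹ ≤ 4 * r⁻¹ := by
    have := Real.exp_one_lt_d9
    linarith
  have hxpos : 0 < Real.exp 1 + r⁻¹ := by positivity
  have hlog1 : 1 ≤ Real.log (Real.exp 1 + r⁻¹) := by
    rw [Real.le_log_iff_exp_le hxpos]; exact hx1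
  have hlog2 := Real.log_le_rpow_div hxpos.le (show 0 < e / T by positivity)
  calc Real.log (Real.exp 1 + r⁻¹) ^ τ ≤ Real.log (Real.exp 1 + r⁻¹) ^ T :=
        Real.rpow_le_rpow_of_exponent_le hlog1 (by rw [hT]; linarith [le_abs_self τ])
    _ ≤ ((Real.exp 1 + r⁻¹) ^ (e / T) / (e / T)) ^ T :=
        Real.rpow_le_rpow (by linarith) hlog2 hTpos.le
    _ = (1 / (e / T)) ^ T * (Real.exp 1 + r⁻¹) ^ e := by
        rw [div_eq_mul_one_div, mul_comm, Real.mul_rpow (by positivity) (by positivity),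
          ← Real.rpow_mul hxpos.le, div_mul_cancel₀ _ hTpos.ne']
    _ ≤ (1 / (e / T)) ^ T * (4 * r⁻¹) ^ e := by
        gcongr
    _ = _ := by
        rw [Real.mul_rpow (by norm_num) (by positivity), Real.inv_rpow hr.le, Real.rpow_neg hr.le]
        ring

/-- truncated Cantor point -/
noncomputable def truncPt (l : ℕ → ℝ) (j : ℕ) (σ : Fin j → Bool) : ℝ :=
  -(1 / 2 : ℝ) + ∑ i : Fin j, if σ i then l i - l (i + 1) else 0

lemma aux_tele (l : ℕ → ℝ) (hpos : ∀ j, 0 < l j) (hdec : ∀ j, 2 * l (j + 1) < l j)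
    (ε : ℕ → Bool) (j N : ℕ) :
    ∑ i ∈ Finset.range N, (if ε (i + j) then l (i + j) - l (i + j + 1) else 0) ≤ l j := by
  have hm : ∀ i, 0 ≤ l i - l (i + 1) := fun i => by linarith [hpos i, hdec i, hpos (i+1)]
  have h1 : ∑ i ∈ Finset.range N, (if ε (i + j) then l (i + j) - l (i + j + 1) else 0)
      ≤ ∑ i ∈ Finset.range N, (l (i + j) - l (i + j + 1)) := by
    apply Finset.sum_le_sum
    intro i _
    split_ifs
    · exact le_rfl
    · exact hm _
  have h2 : ∀ N, ∑ i ∈ Finset.range N, (l (i + j) - l (i + j + 1)) = l j - l (N + j) := by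
    intro N
    induction N with
    | zero => simp
    | succ k ih => rw [Finset.sum_range_succ, ih, show k + 1 + j = k + j + 1 by ring]; ring
  rw [h2] at h1
  linarith [hpos (N + j)]

lemma aux_trunc (l : ℕ → ℝ) (hpos : ∀ j, 0 < l j) (hdec : ∀ j, 2 * l (j + 1) < l j)
    (ε : ℕ → Bool) (j : ℕ) :
    truncPt l j (fun i => ε i) ≤ gCantorPoint l ε ∧
      gCantorPoint l ε ≤ truncPt l j (fun i => ε i) + l j := by
  have hm : ∀ i, 0 ≤ l i - l (i + 1) := fun i => by linarith [hpos i, hdec i, hpos (i+1)]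
  have hnn : ∀ i, 0 ≤ (if ε i then l i - l (i + 1) else 0) := fun i => by
    split_ifs
    · exact hm i
    · exact le_rfl
  have hsum : Summable (fun i => if ε i then l i - l (i + 1) else 0) :=
    summable_of_sum_range_le hnn (c := l 0) (fun N => aux_tele l hpos hdec ε 0 N)
  have hsplit := hsum.sum_add_tsum_nat_add j
  have htl : ∑' i, (if ε (i + j) then l (i + j) - l (i + j + 1) else 0) ≤ l j :=
    Real.tsum_le_of_sum_range_le (fun i => hnn (i + j)) (aux_tele l hpos hdec ε j)
  have htl0 : 0 ≤ ∑' i, (if ε (i + j) then l (i + j) - l (i + j + 1) else 0) :=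
    tsum_nonneg (fun i => hnn (i + j))
  unfold truncPt gCantorPoint
  rw [← hsplit, Finset.sum_range]
  constructor <;> linarith

lemma aux_l_tendsto (l : ℕ → ℝ) (h0 : l 0 = 1) (hpos : ∀ j, 0 < l j)
    (hdec : ∀ j, 2 * l (j + 1) < l j) (r : ℝ) (hr : 0 < r) (hr1 : r < 1) :
    ∃ j, l (j + 1) ≤ r ∧ r < l j := by
  have hb : ∀ j, l j ≤ (1/2 : ℝ) ^ j := by
    intro j
    induction j with
    | zero => simp [h0]
    | succ k ih => rw [pow_succ]; linarith [hdec k]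
  obtain ⟨N, hN⟩ := exists_pow_lt_of_lt_one hr (show (1/2:ℝ) < 1 by norm_num)
  have hex : ∃ j, l j ≤ r := ⟨N, (hb N).trans hN.le⟩
  classical
  have hf := Nat.find_spec hex
  have hne : Nat.find hex ≠ 0 := by
    intro h
    rw [h, h0] at hf
    linarith
  obtain ⟨j, hj⟩ := Nat.exists_eq_succ_of_ne_zero hne
  refine ⟨j, by rw [← Nat.succ_eq_add_one, ← hj]; exact hf, ?_⟩
  have := Nat.find_min hex (m := j) (by omega)
  exact not_le.1 this

/-- covering box -/
noncomputable def covBox (n : ℕ) (l : ℕ → ℝ) (j : ℕ) (σ : Fin n → Fin j → Bool) : Set (Euc (n + 1)) :=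
  {x | (∀ i : Fin n, x i.castSucc ∈ Set.Icc (truncPt l j (σ i) - 4 * l j)
      (truncPt l j (σ i) + 5 * l j)) ∧ x (Fin.last n) ∈ Set.Icc (- l j) (l j)}

lemma aux_vol (n : ℕ) (l : ℕ → ℝ) (hpos : ∀ j, 0 < l j) (j : ℕ) (σ : Fin n → Fin j → Bool) :
    volume (covBox n l j σ) = ENNReal.ofReal ((9 * l j) ^ n * (2 * l j)) := by
  have hset : covBox n l j σ = (MeasurableEquiv.toLp 2 (Fin (n+1) → ℝ)).symm ⁻¹'
      (Set.univ.pi (Fin.snoc (α := fun _ => Set ℝ)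
        (fun i : Fin n => Set.Icc (truncPt l j (σ i) - 4 * l j) (truncPt l j (σ i) + 5 * l j))
        (Set.Icc (- l j) (l j)))) := by
    ext x
    simp only [covBox, Set.mem_ofPred_eq, Set.mem_preimage, Set.mem_univ_pi, Fin.forall_fin_succ',
      Fin.snoc_castSucc, Fin.snoc_last]
    rfl
  rw [hset, (EuclideanSpace.volume_preserving_symm_measurableEquiv_toLp (Fin (n+1))).measure_preimage_equiv,
    volume_pi_pi, Fin.prod_univ_castSucc]
  simp only [Fin.snoc_castSucc, Fin.snoc_last, Real.volume_Icc]
  rw [ENNReal.ofReal_mul (by have := hpos j; positivity), ENNReal.ofReal_pow (by have := hpos j; positivity)]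
  congr 1
  · rw [Finset.prod_congr rfl (g := fun _ => ENNReal.ofReal (9 * l j))]
    · simp
    · intro i _
      congr 1; ring
  · congr 1; ring

lemma aux_ratio {L C gam : ℝ} (hL : 0 < L) (hC : 1 ≤ C) (l : ℕ → ℝ)
    (h : ∀ j : ℕ, 1 ≤ j → C⁻¹ * L ^ j * (j : ℝ) ^ gam ≤ l j ∧ l j ≤ C * L ^ j * (j : ℝ) ^ gam) :
    ∀ j : ℕ, 1 ≤ j → l j ≤ (C ^ 2 * L⁻¹ * 2 ^ |gam|) * l (j + 1) := by
  intro j hj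
  have hj1 : (1:ℝ) ≤ j := by exact_mod_cast hj
  have h1 := (h j hj).2
  have h2 := (h (j+1) (by omega)).1
  push_cast at h2
  have h3 : (j:ℝ) ^ gam ≤ 2 ^ |gam| * ((j:ℝ) + 1) ^ gam := by
    rcases le_or_gt 0 gam with hg | hg
    · have e1 : (j:ℝ) ^ gam ≤ ((j:ℝ) + 1) ^ gam := by gcongr; linarith
      have e2 : (1:ℝ) ≤ 2 ^ |gam| := Real.one_le_rpow (by norm_num) (abs_nonneg _)
      have e3 : 0 ≤ ((j:ℝ) + 1) ^ gam := by positivity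
      nlinarith
    · have e1 : (2 * (j:ℝ)) ^ gam ≤ ((j:ℝ) + 1) ^ gam :=
        Real.rpow_le_rpow_of_nonpos (by linarith) (by linarith) hg.le
      rw [Real.mul_rpow (by norm_num) (by linarith)] at e1
      have e2 : (2:ℝ) ^ |gam| * 2 ^ gam = 1 := by
        rw [abs_of_neg hg, ← Real.rpow_add (by norm_num)]; simp
      calc (j:ℝ) ^ gam = 2 ^ |gam| * (2 ^ gam * (j:ℝ) ^ gam) := by rw [← mul_assoc, e2, one_mul]
        _ ≤ _ := by gcongr
  have hC0 : 0 < C := by linarith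
  calc l j ≤ C * L ^ j * (j : ℝ) ^ gam := h1
    _ ≤ C * L ^ j * (2 ^ |gam| * ((j:ℝ) + 1) ^ gam) := by gcongr
    _ = (C ^ 2 * L⁻¹ * 2 ^ |gam|) * (C⁻¹ * L ^ (j+1) * ((j:ℝ) + 1) ^ gam) := by
        field_simp; try ring
    _ ≤ _ := by gcongr

lemma aux_sum {n : ℕ} {D L gam p₀ β : ℝ} (hDpos : 0 < D) (hD : D = ((n : ℝ) + 1) - p₀)
    (hL0 : 0 < L) (hL1 : L < 1) (hLD : (2:ℝ) ^ n * L ^ D = 1)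
    (l : ℕ → ℝ) (hl : IsCantorLengths L gam l) (hβ0 : 0 < β)
    (hβ : β < p₀ ∨ (β = p₀ ∧ gam * D < -1)) :
    Summable (fun j => l (j + 1) ^ (-β) * ((2:ℝ) ^ (j * n) * ((9 * l j) ^ n * (2 * l j)))) := by
  obtain ⟨h0, hpos, hdec, -, C, hC, hcmp⟩ := hl
  set R := C ^ 2 * L⁻¹ * 2 ^ |gam| with hR
  have hC0 : 0 < C := by linarith
  have hRpos : 0 < R := by positivity
  have hrat := aux_ratio hL0 hC l hcmp
  rw [← hR] at hrat
  set e := (n:ℝ) + 1 - β with he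
  have hβp : β ≤ p₀ := by rcases hβ with h | h; exacts [h.le, h.1.le]
  have hepos : 0 < e := by rw [he]; linarith
  set x := (2:ℝ) ^ n * L ^ e with hx
  have hxe : x = L ^ (p₀ - β) := by
    rw [hx, show e = D + (p₀ - β) by rw [he, hD]; ring, Real.rpow_add hL0, ← mul_assoc, hLD,
      one_mul]
  have hs : Summable (fun j : ℕ => x ^ j * (j:ℝ) ^ (gam * e)) := by
    apply aux_summable (by positivity)
    rcases hβ with h | ⟨h, h'⟩
    · left; rw [hxe]; exact Real.rpow_lt_one hL0.le hL1 (by linarith)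
    · right
      constructor
      · rw [hxe, h]; simp
      · rwa [show e = D by rw [he, hD, h]]
  refine (_root_.summable_nat_add_iff 1).1 ?_
  have hs' := ((_root_.summable_nat_add_iff 1).2 hs).mul_left (R ^ β * (9 ^ n * 2) * C ^ e)
  refine Summable.of_nonneg_of_le (fun j => ?_) (fun j => ?_) hs'
  · have := hpos (j+1); have := hpos (j+1+1); positivity
  · generalize hk : j + 1 = k
    have hk1 : 1 ≤ k := by omega
    have hk1' : (1:ℝ) ≤ k := by exact_mod_cast hk1
    have p1 := hpos k
    have p2 := hpos (k+1)
    have a1 : l (k+1) ^ (-β) ≤ R ^ β * l k ^ (-β) := by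
      have : (R * l (k+1)) ^ (-β) ≤ l k ^ (-β) :=
        Real.rpow_le_rpow_of_nonpos p1 (hrat k hk1) (by linarith)
      rw [Real.mul_rpow hRpos.le p2.le] at this
      calc l (k+1) ^ (-β) = R ^ β * (R ^ (-β) * l (k+1) ^ (-β)) := by
            rw [← mul_assoc, ← Real.rpow_add hRpos]; simp
        _ ≤ _ := by gcongr
    have a2 : l k ^ (-β) * (l k ^ n * l k) = l k ^ e := by
      rw [← pow_succ, ← Real.rpow_natCast, ← Real.rpow_add p1]
      congr 1; rw [he]; push_cast; ring
    have a3 : l k ^ e ≤ C ^ e * (L ^ e) ^ k * (k:ℝ) ^ (gam * e) := by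
      calc l k ^ e ≤ (C * L ^ k * (k : ℝ) ^ gam) ^ e :=
            Real.rpow_le_rpow p1.le (hcmp k hk1).2 hepos.le
        _ = _ := by
          rw [Real.mul_rpow (by positivity) (by positivity), Real.mul_rpow (by positivity) (by positivity),
            ← Real.rpow_mul (by positivity), ← Real.rpow_natCast, ← Real.rpow_natCast,
            ← Real.rpow_mul hL0.le, ← Real.rpow_mul hL0.le, mul_comm (k:ℝ) e]
    calc l (k + 1) ^ (-β) * ((2:ℝ) ^ (k * n) * ((9 * l k) ^ n * (2 * l k)))
        ≤ (R ^ β * l k ^ (-β)) * ((2:ℝ) ^ (k * n) * ((9 * l k) ^ n * (2 * l k))) := by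
          gcongr
      _ = R ^ β * (9 ^ n * 2) * (2:ℝ) ^ (k * n) * (l k ^ (-β) * (l k ^ n * l k)) := by
          rw [mul_pow]; ring
      _ ≤ R ^ β * (9 ^ n * 2) * (2:ℝ) ^ (k * n) * (C ^ e * (L ^ e) ^ k * (k:ℝ) ^ (gam * e)) := by
          rw [a2]; gcongr
      _ = _ := by
          rw [hx, mul_pow, ← pow_mul, mul_comm n k]; ring

lemma frontC_cont {n : ℕ} : Continuous (frontC (n := n)) := by
  unfold frontC; fun_prop

lemma lastC_cont {n : ℕ} : Continuous (lastC (n := n)) := by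
  unfold lastC; fun_prop

/-- slab -/
def slabS (n : ℕ) (l : ℕ → ℝ) (j : ℕ) : Set (Euc (n + 1)) :=
  {x | l (j + 1) ≤ |lastC x| ∧ |lastC x| < l j ∧
    Metric.infDist (frontC x) (gCantorSetPi l n) ≤ 4 * |lastC x|}

lemma slab_meas (n : ℕ) (l : ℕ → ℝ) (j : ℕ) : MeasurableSet (slabS n l j) := by
  have h1 : Measurable (fun x : Euc (n+1) => |lastC x|) := lastC_cont.abs.measurable
  have h2 : Measurable (fun x : Euc (n+1) => Metric.infDist (frontC x) (gCantorSetPi l n)) :=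
    ((Metric.continuous_infDist_pt _).comp frontC_cont).measurable
  exact (measurableSet_le measurable_const h1).inter
    ((measurableSet_lt h1 measurable_const).inter (measurableSet_le h2 (h1.const_mul 4)))

lemma slab_vol (n : ℕ) (l : ℕ → ℝ) (hpos : ∀ j, 0 < l j) (hdec : ∀ j, 2 * l (j + 1) < l j)
    (j : ℕ) :
    volume (slabS n l j) ≤ ENNReal.ofReal ((2:ℝ) ^ (j * n) * ((9 * l j) ^ n * (2 * l j))) := by
  have hne : (gCantorSetPi l n).Nonempty :=
    ⟨WithLp.toLp 2 fun _ => gCantorPoint l (fun _ => true), fun i => ⟨_, rfl⟩⟩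
  have hsub : slabS n l j ⊆ ⋃ σ : Fin n → Fin j → Bool, covBox n l j σ := by
    rintro x ⟨-, h2, h3⟩
    obtain ⟨y, hy, hd⟩ := (Metric.infDist_lt_iff hne).1
      (show Metric.infDist (frontC x) (gCantorSetPi l n) < 4 * l j by linarith)
    choose ε hε using hy
    rw [Set.mem_iUnion]
    refine ⟨fun i k => ε i k, fun i => ?_, ?_⟩
    · have hc : |x i.castSucc - y i| < 4 * l j := by
        have := PiLp.norm_apply_le (frontC x - y) i
        rw [← dist_eq_norm] at this
        have e : (frontC x - y) i = x i.castSucc - y i := rfl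
        rw [e, Real.norm_eq_abs] at this
        linarith
      have ht := aux_trunc l hpos hdec (ε i) j
      rw [hε i] at ht
      rw [abs_lt] at hc
      constructor <;> linarith [ht.1, ht.2, hc.1, hc.2]
    · have := abs_lt.1 h2
      exact ⟨this.1.le, this.2.le⟩
  calc volume (slabS n l j) ≤ volume (⋃ σ : Fin n → Fin j → Bool, covBox n l j σ) :=
        measure_mono hsub
    _ ≤ ∑ σ : Fin n → Fin j → Bool, volume (covBox n l j σ) := measure_iUnion_fintype_le _ _
    _ = _ := by
        simp only [aux_vol n l hpos]
        rw [Finset.sum_const, ENNReal.ofReal_mul (p := (2:ℝ) ^ (j * n)) (by positivity),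
          ENNReal.ofReal_pow (by norm_num)]
        simp [pow_mul]

/-- weight -/
noncomputable def wgt (n : ℕ) (l : ℕ → ℝ) (β : ℝ) (x : Euc (n + 1)) : ℝ :=
  if Metric.infDist (frontC x) (gCantorSetPi l n) ≤ 4 * |lastC x| then |lastC x| ^ (-β) else 0

lemma aux_key {n : ℕ} {D L gam p₀ β : ℝ} (hDpos : 0 < D) (hD : D = ((n : ℝ) + 1) - p₀)
    (hL0 : 0 < L) (hL1 : L < 1) (hLD : (2:ℝ) ^ n * L ^ D = 1)
    (l : ℕ → ℝ) (hl : IsCantorLengths L gam l) (hβ0 : 0 < β)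
    (hβ : β < p₀ ∨ (β = p₀ ∧ gam * D < -1)) :
    ∫⁻ x in Box (n + 1), ENNReal.ofReal (wgt n l β x) < ⊤ := by
  have hsum := aux_sum hDpos hD hL0 hL1 hLD l hl hβ0 hβ
  obtain ⟨h0, hpos, hdec, -, -⟩ := hl
  have hBox : MeasurableSet (Box (n+1)) := by
    have : Box (n+1) = ⋂ i, {x : Euc (n+1) | |x i| < 1} := by
      ext x; simp [Box]
    rw [this]
    refine MeasurableSet.iInter fun i => measurableSet_lt ?_ measurable_const
    exact (by fun_prop : Continuous (fun x : Euc (n+1) => |x i|)).measurable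
  calc ∫⁻ x in Box (n + 1), ENNReal.ofReal (wgt n l β x)
      ≤ ∫⁻ x in Box (n + 1), ∑' j, (slabS n l j).indicator
          (fun _ => ENNReal.ofReal (l (j+1) ^ (-β))) x := by
        refine setLIntegral_mono' hBox (fun x hx => ?_)
        unfold wgt
        split_ifs with hd
        · rcases eq_or_ne (lastC x) 0 with hz | hz
          · rw [hz, abs_zero, Real.zero_rpow (by linarith)]; simp
          · obtain ⟨j, hj1, hj2⟩ := aux_l_tendsto l h0 hpos hdec |lastC x| (abs_pos.2 hz) (hx _)
            refine le_trans ?_ (ENNReal.le_tsum j)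
            rw [Set.indicator_of_mem (show x ∈ slabS n l j from ⟨hj1, hj2, hd⟩)]
            exact ENNReal.ofReal_le_ofReal
              (Real.rpow_le_rpow_of_nonpos (hpos _) hj1 (by linarith))
        · simp
    _ ≤ ∫⁻ x, ∑' j, (slabS n l j).indicator
          (fun _ => ENNReal.ofReal (l (j+1) ^ (-β))) x := setLIntegral_le_lintegral _ _
    _ = ∑' j, ENNReal.ofReal (l (j+1) ^ (-β)) * volume (slabS n l j) := by
        rw [lintegral_tsum (fun j => (measurable_const.indicator (slab_meas n l j)).aemeasurable)]
        exact tsum_congr fun j => lintegral_indicator_const (slab_meas n l j) _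
    _ ≤ ∑' j, ENNReal.ofReal (l (j + 1) ^ (-β) *
          ((2:ℝ) ^ (j * n) * ((9 * l j) ^ n * (2 * l j)))) := by
        refine ENNReal.tsum_le_tsum fun j => ?_
        have := hpos (j+1)
        rw [ENNReal.ofReal_mul (by positivity)]
        gcongr
        exact slab_vol n l hpos hdec j
    _ < ⊤ := hsum.tsum_ofReal_lt_top

lemma lastC_null (n : ℕ) : volume {x : Euc (n + 1) | lastC x = 0} = 0 := by
  let f : Euc (n+1) →ₗ[ℝ] ℝ := (EuclideanSpace.proj (Fin.last n) : Euc (n+1) →L[ℝ] ℝ).toLinearMap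
  have h : {x : Euc (n + 1) | lastC x = 0} = (LinearMap.ker f : Set (Euc (n+1))) := by
    ext x; simp [f, lastC]
  rw [h]
  apply Measure.addHaar_submodule
  intro htop
  have : EuclideanSpace.single (Fin.last n) (1:ℝ) ∈ LinearMap.ker f := by rw [htop]; trivial
  simp [f] at this

/-- conversion of a pointwise bound into a constant -/
lemma aux_const {n : ℕ} {l : ℕ → ℝ} {β : ℝ}
    (hfin : ∫⁻ x in Box (n + 1), ENNReal.ofReal (wgt n l β x) < ⊤) {M θ : ℝ} (hM : 0 ≤ M)
    (E : ℝ → Euc (n + 1) → ℝ≥0∞)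
    (hE : ∀ η : ℝ, 0 < η → ∀ᵐ x ∂(volume : Measure (Euc (n+1))), x ∈ Box (n + 1) →
      E η x ≤ ENNReal.ofReal (η ^ θ * M * wgt n l β x)) :
    ∃ A : ℝ, 0 ≤ A ∧ ∀ η : ℝ, 0 < η →
      ∫⁻ x in Box (n + 1), E η x ≤ ENNReal.ofReal (A * η ^ θ) := by
  refine ⟨M * (∫⁻ x in Box (n + 1), ENNReal.ofReal (wgt n l β x)).toReal, by positivity,
    fun η hη => ?_⟩
  have hBox : MeasurableSet (Box (n+1)) := by
    have : Box (n+1) = ⋂ i, {x : Euc (n+1) | |x i| < 1} := by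
      ext x; simp [Box]
    rw [this]
    refine MeasurableSet.iInter fun i => measurableSet_lt ?_ measurable_const
    exact (by fun_prop : Continuous (fun x : Euc (n+1) => |x i|)).measurable
  calc ∫⁻ x in Box (n + 1), E η x
      ≤ ∫⁻ x in Box (n + 1), ENNReal.ofReal (η ^ θ * M) * ENNReal.ofReal (wgt n l β x) := by
        refine setLIntegral_mono_ae' hBox ?_
        filter_upwards [hE η hη] with x hx hxB
        refine (hx hxB).trans_eq ?_
        rw [ENNReal.ofReal_mul (by positivity)]
    _ = ENNReal.ofReal (η ^ θ * M) * ∫⁻ x in Box (n + 1), ENNReal.ofReal (wgt n l β x) :=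
        lintegral_const_mul' _ _ ENNReal.ofReal_ne_top
    _ = ENNReal.ofReal (η ^ θ * M) *
        ENNReal.ofReal (∫⁻ x in Box (n + 1), ENNReal.ofReal (wgt n l β x)).toReal := by
        rw [ENNReal.ofReal_toReal hfin.ne]
    _ = _ := by
        rw [← ENNReal.ofReal_mul (by positivity)]
        congr 1; ring

lemma aux_choose {A B κ p q q' : ℝ} (hA : 0 ≤ A) (hB : 0 ≤ B) (hκ : 0 < κ) (hp : 1 < p)
    (hpq : p < q) (hqq : q.HolderConjugate q') :
    ∃ η s : ℝ, 0 < η ∧ 0 < s ∧ A * η ^ p + B * s ^ q' < κ * η * s := by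
  have hq0 : 0 < q := by linarith
  have hq'0 : 0 < q' := hqq.symm.pos
  set c := 1 / p - 1 / q with hc
  have hcpos : 0 < c := by
    have : 1 / q < 1 / p := one_div_lt_one_div_of_lt (by linarith) hpq
    linarith
  set y := (A + B) / κ + 1 with hy
  have hypos : 0 < y := by positivity
  set ε := y ^ (1 / c) with hε
  have hεpos : 0 < ε := by positivity
  refine ⟨ε ^ (1 / p), ε ^ (1 / q'), by positivity, by positivity, ?_⟩
  have h1 : (ε ^ (1 / p)) ^ p = ε := by
    rw [← Real.rpow_mul hεpos.le, one_div_mul_cancel (by linarith), Real.rpow_one]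
  have h2 : (ε ^ (1 / q')) ^ q' = ε := by
    rw [← Real.rpow_mul hεpos.le, one_div_mul_cancel hq'0.ne', Real.rpow_one]
  have h3 : ε ^ (1 / p) * ε ^ (1 / q') = ε * y := by
    have : 1 / p + 1 / q' = 1 + c := by
      have := hqq.inv_add_inv_eq_one
      rw [hc]; simp only [one_div]; linarith
    rw [← Real.rpow_add hεpos, this, Real.rpow_add hεpos, Real.rpow_one]
    congr 1
    rw [hε, ← Real.rpow_mul hypos.le, one_div_mul_cancel hcpos.ne', Real.rpow_one]
  rw [h1, h2, mul_assoc, h3]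
  have : κ * (ε * y) = (A + B) * ε + κ * ε := by
    rw [hy]; field_simp
  rw [this]
  nlinarith [mul_pos hκ hεpos]

/-- The subdimensional double phase model `φ(x,t) = t^p/p + a(x) t^q/q` with
weight `a(x) = |x_d|^α ρ_a(x)` satisfies the main assumption: if `q > p₀ + α` and either
`p < p₀`, or `p = p₀` and `γ𝔇 < −1`, then `F(u) < ∞`, `F*(b) < ∞`, and for every `κ > 0`
there are `η, s > 0` with `F(η u) + F*(s b) < κ η s` (here `d = n+1`, `𝔇 = d − p₀`,
`λ = 2^{(1−d)/𝔇}`). -/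
theorem double_phase_sub_main_assumption
    {n : ℕ} (hn : 1 ≤ n) (p₀ gam D lam : ℝ) (hp₀ : 1 < p₀) (hp₀d : p₀ < (n : ℝ) + 1)
    (hD : D = ((n : ℝ) + 1) - p₀) (hlam : lam = 2 ^ ((1 - ((n : ℝ) + 1)) / D))
    (l : ℕ → ℝ) (hl : IsCantorLengths lam gam l)
    -- the competitor `u = (1/2) sgn(x_d) ρ(x)`
    (ρ : Euc (n + 1) → ℝ)
    (hρsmooth : ContDiffOn ℝ (⊤ : ℕ∞) ρ
      {x : Euc (n + 1) | frontC x ∈ gCantorSetPi l n ∧ lastC x = 0}ᶜ)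
    (hρ1 : ∀ x : Euc (n + 1),
      (if Metric.infDist (frontC x) (gCantorSetPi l n) ≤ 2 * |lastC x| then (1 : ℝ) else 0)
        ≤ ρ x)
    (hρ2 : ∀ x : Euc (n + 1),
      ρ x ≤ if Metric.infDist (frontC x) (gCantorSetPi l n) ≤ 4 * |lastC x| then 1 else 0)
    (hρ3 : ∃ C : ℝ, 0 < C ∧ ∀ x : Euc (n + 1),
      ¬(frontC x ∈ gCantorSetPi l n ∧ lastC x = 0) →
      ‖fderiv ℝ ρ x‖ ≤ C * |lastC x|⁻¹ *
        (if 2 * |lastC x| ≤ Metric.infDist (frontC x) (gCantorSetPi l n) ∧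
            Metric.infDist (frontC x) (gCantorSetPi l n) ≤ 4 * |lastC x| then 1 else 0))
    (u : Euc (n + 1) → ℝ) (hu : ∀ x, u x = (1 / 2) * Real.sign (lastC x) * ρ x)
    -- the auxiliary function `b`
    (b : Euc (n + 1) → ℝ)
    (hb : ∀ x : Euc (n + 1), b x =
      (if Metric.infDist (frontC x) (gCantorSetPi l n) ≤ |lastC x| / 2 then (1 : ℝ) else 0) *
        |lastC x| ^ (D + 1 - ((n : ℝ) + 1)) *
        Real.log (Real.exp 1 + |lastC x|⁻¹) ^ (-(gam * D)))
    -- the cut-off `ρ_a` and the weight `a(x) = |x_d|^α ρ_a(x)`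
    (α p q : ℝ) (hα : 0 < α) (hp1 : 1 < p) (hpq : p < q)
    (ρa : Euc (n + 1) → ℝ)
    (hρasmooth : ContDiffOn ℝ (⊤ : ℕ∞) ρa
      {x : Euc (n + 1) | frontC x ∈ gCantorSetPi l n ∧ lastC x = 0}ᶜ)
    (hρa1 : ∀ x : Euc (n + 1),
      (if Metric.infDist (frontC x) (gCantorSetPi l n) ≤ |lastC x| / 2 then (1 : ℝ) else 0)
        ≤ ρa x)
    (hρa2 : ∀ x : Euc (n + 1),
      ρa x ≤ if Metric.infDist (frontC x) (gCantorSetPi l n) ≤ 2 * |lastC x| then 1 else 0)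
    (hρa3 : ∃ C : ℝ, 0 < C ∧ ∀ x : Euc (n + 1),
      ¬(frontC x ∈ gCantorSetPi l n ∧ lastC x = 0) →
      ‖fderiv ℝ ρa x‖ ≤ C * |lastC x|⁻¹ *
        (if |lastC x| / 2 ≤ Metric.infDist (frontC x) (gCantorSetPi l n) ∧
            Metric.infDist (frontC x) (gCantorSetPi l n) ≤ 2 * |lastC x| then 1 else 0))
    (a : Euc (n + 1) → ℝ) (ha : ∀ x, a x = |lastC x| ^ α * ρa x)
    (hq : p₀ + α < q) (hcase : p < p₀ ∨ (p = p₀ ∧ gam * D < -1)) :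
    energyOf (Box (n + 1)) (fun x t => t ^ p / p + a x * t ^ q / q)
      (fun x => ‖fderiv ℝ u x‖) < ⊤ ∧
    energyConj (Box (n + 1)) (fun x t => t ^ p / p + a x * t ^ q / q)
      (fun x => |b x|) < ⊤ ∧
    ∀ κ : ℝ, 0 < κ → ∃ η s : ℝ, 0 < η ∧ 0 < s ∧
      energyOf (Box (n + 1)) (fun x t => t ^ p / p + a x * t ^ q / q)
          (fun x => η * ‖fderiv ℝ u x‖) +
        energyConj (Box (n + 1)) (fun x t => t ^ p / p + a x * t ^ q / q)
          (fun x => s * |b x|) < ENNReal.ofReal (κ * η * s) := by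
  have hnpos : (1:ℝ) ≤ n := by exact_mod_cast hn
  have hDpos : 0 < D := by rw [hD]; linarith
  have hL0 : 0 < lam := by rw [hlam]; positivity
  have hL1 : lam < 1 := by
    rw [hlam]
    apply Real.rpow_lt_one_of_one_lt_of_neg (by norm_num)
    exact div_neg_of_neg_of_pos (by linarith) hDpos
  have hLD : (2:ℝ) ^ n * lam ^ D = 1 := by
    rw [hlam, ← Real.rpow_mul (by norm_num), div_mul_cancel₀ _ hDpos.ne', ← Real.rpow_natCast,
      ← Real.rpow_add (by norm_num)]
    simp
  have hp0 : 0 < p := by linarith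
  have hq0 : 0 < q := by linarith
  have hρa0 : ∀ x, 0 ≤ ρa x := fun x => le_trans (by split_ifs <;> norm_num) (hρa1 x)
  have ha0 : ∀ x, 0 ≤ a x := fun x => by
    rw [ha]; exact mul_nonneg (by positivity) (hρa0 x)
  -- first energy
  have hF : ∃ A : ℝ, 0 ≤ A ∧ ∀ η : ℝ, 0 < η →
      energyOf (Box (n + 1)) (fun x t => t ^ p / p + a x * t ^ q / q)
        (fun x => η * ‖fderiv ℝ u x‖) ≤ ENNReal.ofReal (A * η ^ p) := by
    obtain ⟨C, hC, hgr⟩ := hρ3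
    refine aux_const (aux_key hDpos hD hL0 hL1 hLD l hl hp0 hcase) (M := C ^ p / p)
      (by positivity) (fun η x => ENNReal.ofReal ((η * ‖fderiv ℝ u x‖) ^ p / p +
        a x * (η * ‖fderiv ℝ u x‖) ^ q / q)) ?_
    intro η hη
    have hae : ∀ᵐ x ∂(volume : Measure (Euc (n+1))), lastC x ≠ 0 := by
      rw [ae_iff]; simpa using lastC_null n
    filter_upwards [hae] with x hx _
    have hxpos : 0 < |lastC x| := abs_pos.2 hx
    apply ENNReal.ofReal_le_ofReal
    have hev : u =ᶠ[𝓝 x] fun y => ((1 / 2) * Real.sign (lastC x)) * ρ y := by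
      rcases lt_or_gt_of_ne hx with h | h
      · filter_upwards [(lastC_cont.tendsto x).eventually (gt_mem_nhds h)] with y hy
        rw [hu, Real.sign_of_neg h, Real.sign_of_neg hy]
      · filter_upwards [(lastC_cont.tendsto x).eventually (lt_mem_nhds h)] with y hy
        rw [hu, Real.sign_of_pos h, Real.sign_of_pos hy]
    have hopen : {x : Euc (n + 1) | frontC x ∈ gCantorSetPi l n ∧ lastC x = 0}ᶜ ∈ 𝓝 x := by
      filter_upwards [(lastC_cont.tendsto x).eventually (isOpen_ne.mem_nhds hx)] with y hy
      intro h; exact hy h.2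
    have hdiff : DifferentiableAt ℝ ρ x :=
      (hρsmooth.contDiffAt hopen).differentiableAt (by simp)
    have hfd : fderiv ℝ u x = ((1 / 2) * Real.sign (lastC x)) • fderiv ℝ ρ x := by
      rw [hev.fderiv_eq]
      exact fderiv_const_mul hdiff _
    have hsg : |(1 / 2) * Real.sign (lastC x)| ≤ 1 := by
      rcases Real.sign_apply_eq (lastC x) with h | h | h <;> rw [h] <;> norm_num [abs_le]
    have hnorm : ‖fderiv ℝ u x‖ ≤ ‖fderiv ℝ ρ x‖ := by
      rw [hfd, norm_smul, Real.norm_eq_abs]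
      exact mul_le_of_le_one_left (norm_nonneg _) hsg
    have hw0 : 0 ≤ wgt n l p x := by unfold wgt; split_ifs <;> positivity
    by_cases hd : Metric.infDist (frontC x) (gCantorSetPi l n) ≤ 2 * |lastC x|
    · have hmax : IsLocalMax ρ x := by
        refine Filter.Eventually.of_forall fun y => ?_
        have h1 := hρ1 x
        rw [if_pos hd] at h1
        have h2 : ρ y ≤ 1 := (hρ2 y).trans (by split_ifs <;> norm_num)
        linarith
      have hz : fderiv ℝ u x = 0 := by rw [hfd, hmax.fderiv_eq_zero, smul_zero]
      rw [hz, norm_zero, mul_zero, Real.zero_rpow hp0.ne', Real.zero_rpow hq0.ne']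
      simp only [zero_div, mul_zero, add_zero]
      positivity
    · have haz : a x = 0 := by
        have := hρa2 x
        rw [if_neg hd] at this
        rw [ha, le_antisymm this (hρa0 x), mul_zero]
      rw [haz, zero_mul, zero_div, add_zero]
      have hg := hgr x (fun h => hx h.2)
      by_cases h4 : Metric.infDist (frontC x) (gCantorSetPi l n) ≤ 4 * |lastC x|
      · have hg' : ‖fderiv ℝ u x‖ ≤ C * |lastC x|⁻¹ := by
          refine (hnorm.trans hg).trans ?_
          have : 0 ≤ C * |lastC x|⁻¹ := by positivity
          split_ifs <;> simp [this]
        unfold wgt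
        rw [if_pos h4]
        calc (η * ‖fderiv ℝ u x‖) ^ p / p ≤ (η * (C * |lastC x|⁻¹)) ^ p / p := by gcongr
          _ = η ^ p * (C ^ p / p) * |lastC x| ^ (-p) := by
            rw [Real.mul_rpow hη.le (by positivity), Real.mul_rpow hC.le (by positivity),
              Real.inv_rpow hxpos.le, Real.rpow_neg hxpos.le]
            ring
      · rw [if_neg (fun h => h4 h.2), mul_zero] at hg
        have hz : ‖fderiv ℝ u x‖ = 0 := le_antisymm (hnorm.trans hg) (norm_nonneg _)
        rw [hz, mul_zero, Real.zero_rpow hp0.ne', zero_div]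
        positivity
  -- conjugate energy
  have hq1 : 1 < q := by linarith
  have hqq : q.HolderConjugate (q / (q - 1)) := Real.HolderConjugate.conjExponent hq1
  set q' := q / (q - 1) with hq'
  have hq'0 : 0 < q' := hqq.symm.pos
  have hG : ∃ B : ℝ, 0 ≤ B ∧ ∀ s : ℝ, 0 < s →
      energyConj (Box (n + 1)) (fun x t => t ^ p / p + a x * t ^ q / q)
        (fun x => s * |b x|) ≤ ENNReal.ofReal (B * s ^ q') := by
    set w := α / q * q' + (p₀ - 1) * q' with hw
    have hwp : w < p₀ := by
      have : w = (α + (p₀ - 1) * q) / (q - 1) := by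
        have : q - 1 ≠ 0 := by linarith
        rw [hw, hq']; field_simp
      rw [this, div_lt_iff₀ (by linarith)]
      nlinarith
    have hw0 : 0 < w := by
      have : 0 < p₀ - 1 := by linarith
      positivity
    set e := (p₀ - w) / 2 with he
    have hepos : 0 < e := by rw [he]; linarith
    obtain ⟨C, hC, hlog⟩ := aux_log (τ := -(gam * D) * q') hepos
    refine aux_const (aux_key hDpos hD hL0 hL1 hLD l hl (β := w + e) (by linarith)
      (Or.inl (by linarith))) (M := C / q')
      (by positivity) (fun s x => conjOrlicz (fun t => t ^ p / p + a x * t ^ q / q) (s * |b x|)) ?_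
    intro s hs
    refine Filter.Eventually.of_forall fun x hxB => ?_
    have hw0 : 0 ≤ wgt n l (w + e) x := by unfold wgt; split_ifs <;> positivity
    refine iSup_le fun t => ENNReal.ofReal_le_ofReal ?_
    have ht : (0:ℝ) ≤ t := t.2
    have hφ1 : (0:ℝ) ≤ (t:ℝ) ^ p / p := by positivity
    have hφ2 : 0 ≤ a x * (t:ℝ) ^ q / q := by have := ha0 x; positivity
    by_cases hbz : b x = 0
    · rw [hbz, abs_zero, mul_zero, zero_mul]
      have : 0 ≤ s ^ q' * (C / q') * wgt n l (w + e) x := by positivity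
      linarith
    have hx : lastC x ≠ 0 := by
      intro h
      apply hbz
      rw [hb, h, abs_zero, Real.zero_rpow (by rw [hD]; linarith), mul_zero, zero_mul]
    have hd : Metric.infDist (frontC x) (gCantorSetPi l n) ≤ |lastC x| / 2 := by
      by_contra h
      apply hbz
      rw [hb, if_neg h, zero_mul, zero_mul]
    set r := |lastC x| with hr
    have hrpos : 0 < r := abs_pos.2 hx
    have hr1 : r < 1 := hxB _
    have hax : a x = r ^ α := by
      have h1 := hρa1 x
      rw [if_pos hd] at h1
      have h2 : ρa x ≤ 1 := (hρa2 x).trans (by split_ifs <;> norm_num)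
      rw [ha, le_antisymm h2 h1, mul_one]
    set Lg := Real.log (Real.exp 1 + r⁻¹) with hLg
    have hLpos : 0 < Lg := by
      apply Real.log_pos
      have := Real.add_one_le_exp (1:ℝ)
      have : 0 < r⁻¹ := by positivity
      linarith
    have hbx : |b x| = r ^ (1 - p₀) * Lg ^ (-(gam * D)) := by
      rw [hb, if_pos hd, one_mul, show D + 1 - ((n:ℝ) + 1) = 1 - p₀ by rw [hD]; ring]
      exact abs_of_nonneg (by positivity)
    have hwx : wgt n l (w + e) x = r ^ (-(w + e)) := by
      unfold wgt; rw [if_pos (by linarith)]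
    have hy := Real.young_inequality_of_nonneg (a := r ^ (α / q) * t)
      (b := r ^ (-(α / q)) * (s * |b x|)) (by positivity) (by positivity) hqq
    have e1 : r ^ (α / q) * t * (r ^ (-(α / q)) * (s * |b x|)) = s * |b x| * t := by
      have : r ^ (α / q) * r ^ (-(α / q)) = 1 := by rw [← Real.rpow_add hrpos]; simp
      linear_combination (s * |b x| * t) * this
    have e2 : (r ^ (α / q) * t) ^ q = a x * (t:ℝ) ^ q := by
      rw [Real.mul_rpow (by positivity) ht, ← Real.rpow_mul hrpos.le, div_mul_cancel₀ _ hq0.ne',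
        hax]
    have e3 : (r ^ (-(α / q)) * (s * |b x|)) ^ q' = s ^ q' * (r ^ (-w) * Lg ^ (-(gam * D) * q')) := by
      rw [hbx, Real.mul_rpow (by positivity) (by positivity), Real.mul_rpow hs.le (by positivity),
        Real.mul_rpow (by positivity) (by positivity), ← Real.rpow_mul hrpos.le,
        ← Real.rpow_mul hrpos.le, ← Real.rpow_mul hLpos.le,
        show -w = -(α / q) * q' + (1 - p₀) * q' by rw [hw]; ring, Real.rpow_add hrpos]
      ring
    rw [e1, e2, e3] at hy
    have hl1 := hlog r hrpos hr1
    have e4 : s ^ q' * (r ^ (-w) * Lg ^ (-(gam * D) * q')) / q' ≤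
        s ^ q' * (C / q') * wgt n l (w + e) x := by
      calc s ^ q' * (r ^ (-w) * Lg ^ (-(gam * D) * q')) / q'
          ≤ s ^ q' * (r ^ (-w) * (C * r ^ (-e))) / q' := by gcongr
        _ = _ := by
          rw [hwx, show -(w + e) = -w + -e by ring, Real.rpow_add hrpos]; ring
    linarith
  obtain ⟨A, hA, hF⟩ := hF
  obtain ⟨B, hB, hG⟩ := hG
  refine ⟨?_, ?_, ?_⟩
  · have := hF 1 one_pos
    simp only [one_mul] at this
    exact this.trans_lt ENNReal.ofReal_lt_top
  · have := hG 1 one_pos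
    simp only [one_mul] at this
    exact this.trans_lt ENNReal.ofReal_lt_top
  · intro κ hκ
    obtain ⟨η, s, hη, hs, h⟩ := aux_choose hA hB hκ hp1 hpq hqq
    refine ⟨η, s, hη, hs, (add_le_add (hF η hη) (hG s hs)).trans_lt ?_⟩
    rw [← ENNReal.ofReal_add (by positivity) (by positivity)]
    exact (ENNReal.ofReal_lt_ofReal_iff (by positivity)).2 h
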